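/- The variance of the total length (α = 1) of the nearest-neighbour directed graph on n ≥ 4 i.i.d. uniform points in (0,1) equals (2n^2 + 17n + 12)/(12(n+1)^2(n+2)), which equals (1/6)n^{-1} + O(n^{-2}). -/

import Mathlib

open MeasureTheory Asymptotics

/-- The law of `n` i.i.d. uniform points on `(0,1)`. -/
noncomputable def unif (n : ℕ) : Measure (Fin n → ℝ) :=
  Measure.pi fun _ => volume.restrict (Set.Ioo (0:ℝ) 1)

/-- Total `α`-power-weighted length of the nearest-neighbour (directed) graph on the
points `x 0, …, x (m-1)`: each point is joined by a directed edge to its nearest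
neighbour among the other points. -/
noncomputable def nnWeight (α : ℝ) {m : ℕ} (x : Fin m → ℝ) : ℝ :=
  ∑ i : Fin m, (sInf {d : ℝ | ∃ j : Fin m, j ≠ i ∧ d = |x i - x j|}) ^ α

open ProbabilityTheory

noncomputable def mexp : Measure ℝ :=
  (volume.restrict (Set.Ioi (0:ℝ))).withDensity (fun x => ENNReal.ofReal (Real.exp (-x)))

lemma integral_mexp (f : ℝ → ℝ) : ∫ x, f x ∂mexp = ∫ x in Set.Ioi (0:ℝ), Real.exp (-x) * f x := by
  unfold mexp
  rw [integral_withDensity_eq_integral_toReal_smul (by fun_prop) (by simp)]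
  simp [ENNReal.toReal_ofReal (Real.exp_pos _).le]

lemma integrable_mexp_iff (f : ℝ → ℝ) : Integrable f mexp ↔
    IntegrableOn (fun x => Real.exp (-x) * f x) (Set.Ioi (0:ℝ)) := by
  unfold mexp
  rw [integrable_withDensity_iff_integrable_smul' (by fun_prop) (by simp)]
  simp [ENNReal.toReal_ofReal (Real.exp_pos _).le, IntegrableOn]

lemma gam_integrableOn (k : ℕ) (a : ℝ) (ha : 0 < a) :
    IntegrableOn (fun x : ℝ => x ^ k * Real.exp (-(a * x))) (Set.Ioi (0:ℝ)) := by
  have := integrableOn_rpow_mul_exp_neg_mul_rpow (p := 1) (s := (k:ℝ)) (b := a)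
    (by have : (0:ℝ) ≤ k := by positivity
        linarith) one_pos ha
  simpa using this

lemma gam_integral (k : ℕ) (a : ℝ) (ha : 0 < a) :
    ∫ x in Set.Ioi (0:ℝ), x ^ k * Real.exp (-(a * x)) = (k.factorial : ℝ) / a ^ (k+1) := by
  have := Real.integral_rpow_mul_exp_neg_mul_Ioi (a := (k:ℝ)+1) (r := a) (by positivity) ha
  rw [Real.Gamma_nat_eq_factorial] at this
  simp only [add_sub_cancel_right, Real.rpow_natCast] at this
  rw [this]
  rw [show ((k:ℝ)+1) = ((k+1 : ℕ) : ℝ) by push_cast; ring, Real.rpow_natCast]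
  rw [one_div, inv_pow]; field_simp

lemma mexp_pe_integrable (k j : ℕ) :
    Integrable (fun x : ℝ => x ^ k * Real.exp (-(j * x))) mexp := by
  rw [integrable_mexp_iff]
  refine (gam_integrableOn k (j+1) (by positivity)).congr_fun (fun x _ => ?_) measurableSet_Ioi
  simp only
  rw [mul_left_comm, ← Real.exp_add]; ring_nf

lemma mexp_pe_integral (k j : ℕ) :
    ∫ x, x ^ k * Real.exp (-(j * x)) ∂mexp = (k.factorial : ℝ) / (j+1) ^ (k+1) := by
  rw [integral_mexp, ← gam_integral k (j+1) (by positivity)]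
  congr 1; ext x
  rw [mul_left_comm, ← Real.exp_add]; ring_nf

instance : IsProbabilityMeasure mexp := by
  constructor
  have h := mexp_pe_integral 0 0
  have h2 := mexp_pe_integrable 0 0
  simp at h
  rw [measureReal_def] at h
  have := ENNReal.toReal_eq_one_iff (mexp Set.univ)
  exact this.1 h

lemma mexp_pos : ∀ᵐ x ∂mexp, 0 < x := by
  have : mexp ≪ volume.restrict (Set.Ioi (0:ℝ)) := withDensity_absolutelyContinuous _ _
  exact this.ae_le (ae_restrict_mem measurableSet_Ioi)

lemma mexp_int_pow (k : ℕ) : Integrable (fun x : ℝ => x ^ k) mexp := by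
  simpa using mexp_pe_integrable k 0

lemma mexp_min {x : ℝ} (hx : 0 < x) : ∫ y, min x y ∂mexp = 1 - Real.exp (-x) := by
  have hi : IntegrableOn (fun y => Real.exp (-y) * min x y) (Set.Ioi 0) := by
    rw [← integrable_mexp_iff]
    exact (integrable_const x).inf (by simpa using mexp_int_pow 1)
  rw [integral_mexp, ← Set.Ioc_union_Ioi_eq_Ioi hx.le, setIntegral_union
    (Set.Ioc_disjoint_Ioi le_rfl) measurableSet_Ioi
    (hi.mono_set Set.Ioc_subset_Ioi_self) (hi.mono_set (Set.Ioi_subset_Ioi hx.le))]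
  have h1 : ∫ y in Set.Ioc 0 x, Real.exp (-y) * min x y = 1 - (x+1) * Real.exp (-x) := by
    rw [setIntegral_congr_fun (g := fun y => Real.exp (-y) * y) measurableSet_Ioc
      (fun y hy => by simp [hy.2])]
    rw [← intervalIntegral.integral_of_le hx.le]
    rw [intervalIntegral.integral_eq_sub_of_hasDerivAt (f := fun y => -(y+1) * Real.exp (-y))]
    · simp; ring
    · intro y _
      have := (((hasDerivAt_id y).add_const 1).neg).mul ((hasDerivAt_id y).neg.exp)
      exact this.congr_deriv (by simp; ring)
    · exact (by fun_prop : Continuous fun y => Real.exp (-y) * y).intervalIntegrable _ _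
  have h2 : ∫ y in Set.Ioi x, Real.exp (-y) * min x y = x * Real.exp (-x) := by
    rw [setIntegral_congr_fun (g := fun y => Real.exp (-y) * x) measurableSet_Ioi
      (fun y (hy : x < y) => by simp [hy.le])]
    rw [integral_mul_const, integral_exp_neg_Ioi]; ring
  rw [h1, h2]; ring

lemma mexp_minE : ∫ x, (1 - Real.exp (-x)) ∂mexp = 1/2 := by
  have h := mexp_pe_integral 0 1
  have h2 := mexp_pe_integrable 0 1
  simp at h h2
  rw [integral_sub (integrable_const _) h2, h]; simp; norm_num

lemma mexp_xmin : ∫ x, x * (1 - Real.exp (-x)) ∂mexp = 3/4 := by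
  have h := mexp_pe_integral 1 1
  have h2 := mexp_pe_integrable 1 1
  have h' := mexp_pe_integral 1 0
  have h2' := mexp_pe_integrable 1 0
  simp at h h2 h' h2'
  simp_rw [mul_sub, mul_one]
  rw [integral_sub h2' h2, h, h']; norm_num

lemma mexp_minmin : ∫ x, (1 - Real.exp (-x)) * (1 - Real.exp (-x)) ∂mexp = 1/3 := by
  have h := mexp_pe_integral 0 1
  have h2 := mexp_pe_integrable 0 1
  have h' := mexp_pe_integral 0 2
  have h2' := mexp_pe_integrable 0 2
  simp at h h2 h' h2'
  have e : ∀ x : ℝ, (1 - Real.exp (-x)) * (1 - Real.exp (-x)) = 1 - 2 * Real.exp (-x) + Real.exp (-(2*x)) := by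
    intro x
    rw [show -(2*x) = -x + -x by ring, Real.exp_add]; ring
  simp_rw [e]
  have h3 : Integrable (fun x : ℝ => 1 - 2 * Real.exp (-x)) mexp := (integrable_const _).sub (h2.const_mul 2)
  rw [integral_add h3 h2', integral_sub (integrable_const _) (h2.const_mul 2), integral_const_mul, h, h']; simp; norm_num
section iid
set_option linter.unusedSectionVars false
variable {Ω : Type*} [MeasurableSpace Ω] {P : Measure Ω} [IsProbabilityMeasure P] {X : ℕ → Ω → ℝ}

lemma iid_integral (hm : ∀ i, Measurable (X i)) (hl : ∀ i, P.map (X i) = mexp) (i : ℕ) (f : ℝ → ℝ)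
    (hf : Measurable f) : ∫ ω, f (X i ω) ∂P = ∫ x, f x ∂mexp := by
  rw [← hl i, integral_map (hm i).aemeasurable hf.aestronglyMeasurable]

lemma iid_pos (hm : ∀ i, Measurable (X i)) (hl : ∀ i, P.map (X i) = mexp) (i : ℕ) :
    ∀ᵐ ω ∂P, 0 < X i ω := by
  have := mexp_pos
  rw [← hl i] at this
  exact ae_of_ae_map (hm i).aemeasurable this

lemma iid_memLp (hm : ∀ i, Measurable (X i)) (hl : ∀ i, P.map (X i) = mexp) (i : ℕ) :
    MemLp (X i) 2 P := by
  rw [memLp_two_iff_integrable_sq (hm i).aestronglyMeasurable]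
  have := mexp_int_pow 2
  rw [← hl i] at this
  exact this.comp_measurable (hm i)

lemma iid_min_memLp (hm : ∀ i, Measurable (X i)) (hl : ∀ i, P.map (X i) = mexp) (i j : ℕ) :
    MemLp (fun ω => min (X i ω) (X j ω)) 2 P :=
  (iid_memLp hm hl i).inf (iid_memLp hm hl j)

lemma iid_E (hm : ∀ i, Measurable (X i)) (hl : ∀ i, P.map (X i) = mexp) (i : ℕ) :
    ∫ ω, X i ω ∂P = 1 := by
  rw [iid_integral hm hl i (fun x => x) measurable_id]
  simpa using mexp_pe_integral 1 0

lemma iid_E2 (hm : ∀ i, Measurable (X i)) (hl : ∀ i, P.map (X i) = mexp) (i : ℕ) :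
    ∫ ω, X i ω * X i ω ∂P = 2 := by
  rw [iid_integral hm hl i (fun x => x * x) (by fun_prop)]
  have := mexp_pe_integral 2 0
  simpa [pow_two] using this

lemma iid_pair (hm : ∀ i, Measurable (X i)) (hl : ∀ i, P.map (X i) = mexp)
    (hi : iIndepFun X P) {i j : ℕ} (hij : i ≠ j) (f : ℝ × ℝ → ℝ) (hf : Measurable f)
    (hint : Integrable (fun ω => f (X i ω, X j ω)) P) :
    ∫ ω, f (X i ω, X j ω) ∂P = ∫ x, ∫ y, f (x, y) ∂mexp ∂mexp := by
  have h := (indepFun_iff_map_prod_eq_prod_map_map (hm i).aemeasurable (hm j).aemeasurable).1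
    (hi.indepFun hij)
  rw [hl, hl] at h
  have hM : Measurable (fun ω => (X i ω, X j ω)) := (hm i).prodMk (hm j)
  rw [← integral_prod, ← h, integral_map hM.aemeasurable hf.aestronglyMeasurable]
  rw [← h, integrable_map_measure hf.aestronglyMeasurable hM.aemeasurable]
  exact hint

lemma iid_Emin (hm : ∀ i, Measurable (X i)) (hl : ∀ i, P.map (X i) = mexp)
    (hi : iIndepFun X P) {i j : ℕ} (hij : i ≠ j) :
    ∫ ω, min (X i ω) (X j ω) ∂P = 1/2 := by
  rw [iid_pair hm hl hi hij (fun p => min p.1 p.2) (by fun_prop)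
    ((iid_min_memLp hm hl i j).integrable one_le_two)]
  rw [← mexp_minE]
  refine integral_congr_ae ?_
  filter_upwards [mexp_pos] with x hx
  exact mexp_min hx

lemma iid_Exmin (hm : ∀ i, Measurable (X i)) (hl : ∀ i, P.map (X i) = mexp)
    (hi : iIndepFun X P) {i j : ℕ} (hij : i ≠ j) :
    ∫ ω, X i ω * min (X i ω) (X j ω) ∂P = 3/4 := by
  rw [iid_pair hm hl hi hij (fun p => p.1 * min p.1 p.2) (by fun_prop)
    ((iid_memLp hm hl i).integrable_mul (iid_min_memLp hm hl i j))]
  rw [← mexp_xmin]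
  refine integral_congr_ae ?_
  filter_upwards [mexp_pos] with x hx
  rw [integral_const_mul, mexp_min hx]

lemma iid_Emin2 (hm : ∀ i, Measurable (X i)) (hl : ∀ i, P.map (X i) = mexp)
    (hi : iIndepFun X P) {i j : ℕ} (hij : i ≠ j) :
    ∫ ω, min (X i ω) (X j ω) * min (X i ω) (X j ω) ∂P = 1/2 := by
  have e : ∀ ω, min (X i ω) (X j ω) * min (X i ω) (X j ω) =
      X i ω * min (X i ω) (X j ω) + X j ω * min (X j ω) (X i ω) - X i ω * X j ω := by
    intro ω
    rcases le_total (X i ω) (X j ω) with h | h <;> (simp [h]; try ring)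
  simp_rw [e]
  have i1 : Integrable (fun ω => X i ω * min (X i ω) (X j ω)) P :=
    (iid_memLp hm hl i).integrable_mul (iid_min_memLp hm hl i j)
  have i2 : Integrable (fun ω => X j ω * min (X j ω) (X i ω)) P :=
    (iid_memLp hm hl j).integrable_mul (iid_min_memLp hm hl j i)
  have i3 : Integrable (fun ω => X i ω * X j ω) P :=
    (iid_memLp hm hl i).integrable_mul (iid_memLp hm hl j)
  have i12 : Integrable (fun ω => X i ω * min (X i ω) (X j ω) + X j ω * min (X j ω) (X i ω)) P :=
    i1.add i2
  rw [integral_sub i12 i3, integral_add i1 i2, iid_Exmin hm hl hi hij,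
    iid_Exmin hm hl hi hij.symm,
    (hi.indepFun hij).integral_fun_mul_eq_mul_integral (hm i).aestronglyMeasurable
      (hm j).aestronglyMeasurable, iid_E hm hl, iid_E hm hl]
  norm_num

lemma iid_Eminmin (hm : ∀ i, Measurable (X i)) (hl : ∀ i, P.map (X i) = mexp)
    (hi : iIndepFun X P) {i j k : ℕ} (hij : i ≠ j) (hik : i ≠ k) (hjk : j ≠ k) :
    ∫ ω, min (X i ω) (X j ω) * min (X i ω) (X k ω) ∂P = 1/3 := by
  have h1 := (indepFun_iff_map_prod_eq_prod_map_map (hm j).aemeasurable (hm k).aemeasurable).1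
    (hi.indepFun hjk)
  have hM : Measurable (fun ω => (X j ω, X k ω)) := (hm j).prodMk (hm k)
  have h2 := (indepFun_iff_map_prod_eq_prod_map_map (hm i).aemeasurable hM.aemeasurable).1
    (hi.indepFun_prodMk hm j k i hij.symm hik.symm).symm
  have hM2 : Measurable (fun ω => (X i ω, (X j ω, X k ω))) := (hm i).prodMk hM
  rw [h1, hl, hl, hl] at h2
  have hf : Measurable (fun p : ℝ × ℝ × ℝ => min p.1 p.2.1 * min p.1 p.2.2) := by fun_prop
  have hint : Integrable (fun ω => min (X i ω) (X j ω) * min (X i ω) (X k ω)) P :=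
    (iid_min_memLp hm hl i j).integrable_mul (iid_min_memLp hm hl i k)
  have e1 : ∫ ω, min (X i ω) (X j ω) * min (X i ω) (X k ω) ∂P =
      ∫ p, min p.1 p.2.1 * min p.1 p.2.2 ∂(mexp.prod (mexp.prod mexp)) := by
    rw [← h2, integral_map hM2.aemeasurable hf.aestronglyMeasurable]
  rw [e1, integral_prod]
  · rw [← mexp_minmin]
    refine integral_congr_ae ?_
    filter_upwards [mexp_pos] with x hx
    rw [integral_prod_mul (fun y => min x y) (fun y => min x y), mexp_min hx]
  · rw [← h2, integrable_map_measure hf.aestronglyMeasurable hM2.aemeasurable]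
    exact hint

/-- The exponential analogue of the total length. -/
noncomputable def Tsum (X : ℕ → Ω → ℝ) (m : ℕ) (ω : Ω) : ℝ :=
  X 0 ω + ∑ i ∈ Finset.range m, min (X i ω) (X (i+1) ω)

lemma Tsum_succ (m : ℕ) : Tsum X (m+1) = Tsum X m + fun ω => min (X m ω) (X (m+1) ω) := by
  ext ω; simp [Tsum, Finset.sum_range_succ, add_assoc]

lemma Tsum_zero : Tsum X 0 = X 0 := by ext ω; simp [Tsum]

lemma Tsum_memLp (hm : ∀ i, Measurable (X i)) (hl : ∀ i, P.map (X i) = mexp) (m : ℕ) :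
    MemLp (Tsum X m) 2 P := by
  induction m with
  | zero => rw [Tsum_zero]; exact iid_memLp hm hl 0
  | succ m ih => rw [Tsum_succ]; exact ih.add (iid_min_memLp hm hl _ _)

lemma Tsum_E (hm : ∀ i, Measurable (X i)) (hl : ∀ i, P.map (X i) = mexp)
    (hi : iIndepFun X P) (m : ℕ) : ∫ ω, Tsum X m ω ∂P = 1 + m/2 := by
  induction m with
  | zero => rw [Tsum_zero, iid_E hm hl]; simp
  | succ m ih =>
    rw [Tsum_succ, integral_add' ((Tsum_memLp hm hl m).integrable one_le_two)
      ((iid_min_memLp hm hl _ _).integrable one_le_two), ih, iid_Emin hm hl hi (by omega)]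
    push_cast; ring

/-- Covariance of a partial sum with a function of later coordinates vanishes. -/
lemma Tsum_cov_far (hm : ∀ i, Measurable (X i)) (hl : ∀ i, P.map (X i) = mexp)
    (hi : iIndepFun X P) (m j k : ℕ) (hj : m < j) (hk : m < k) :
    cov[Tsum X m, fun ω => min (X j ω) (X k ω); P] = 0 := by
  have hY := iid_min_memLp hm hl j k
  induction m with
  | zero =>
    rw [Tsum_zero]
    refine IndepFun.covariance_eq_zero ?_ (iid_memLp hm hl 0) hY
    exact (hi.indepFun_prodMk hm j k 0 (by omega) (by omega)).symm.comp (φ := id) (ψ := fun p : ℝ × ℝ => min p.1 p.2)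
      measurable_id (by fun_prop)
  | succ m ih =>
    rw [Tsum_succ, covariance_add_left (Tsum_memLp hm hl m) (iid_min_memLp hm hl _ _) hY,
      ih (by omega) (by omega), zero_add]
    refine IndepFun.covariance_eq_zero ?_ (iid_min_memLp hm hl _ _) hY
    exact (hi.indepFun_prodMk_prodMk hm m (m+1) j k (by omega) (by omega) (by omega) (by omega)).comp
      (φ := fun p : ℝ × ℝ => min p.1 p.2) (ψ := fun p : ℝ × ℝ => min p.1 p.2)
      (by fun_prop) (by fun_prop)

lemma Tsum_cov_near (hm : ∀ i, Measurable (X i)) (hl : ∀ i, P.map (X i) = mexp)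
    (hi : iIndepFun X P) (m : ℕ) :
    cov[Tsum X (m+1), fun ω => min (X (m+1) ω) (X (m+2) ω); P] = 1/12 := by
  have hY := iid_min_memLp hm hl (m+1) (m+2)
  have h0 := iid_min_memLp hm hl m (m+1)
  rw [Tsum_succ, covariance_add_left (Tsum_memLp hm hl m) h0 hY,
    Tsum_cov_far hm hl hi _ _ _ (by omega) (by omega), covariance_eq_sub h0 hY,
    iid_Emin hm hl hi (by omega), iid_Emin hm hl hi (by omega)]
  have := iid_Eminmin hm hl hi (i := m+1) (j := m) (k := m+2) (by omega) (by omega) (by omega)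
  simp_rw [min_comm (X (m+1) _) (X m _)] at this
  simp only [Pi.mul_apply]
  rw [this]; norm_num

lemma Tsum_cov_last (hm : ∀ i, Measurable (X i)) (hl : ∀ i, P.map (X i) = mexp)
    (hi : iIndepFun X P) (m : ℕ) :
    cov[Tsum X (m+1), X (m+1); P] = 1/4 := by
  have hY := iid_memLp hm hl (m+1)
  have h0 := iid_min_memLp hm hl m (m+1)
  have hfar := Tsum_cov_far hm hl hi m (m+1) (m+1) (by omega) (by omega)
  simp only [min_self] at hfar
  have this := iid_Exmin hm hl hi (i := m+1) (j := m) (by omega)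
  rw [Tsum_succ, covariance_add_left (Tsum_memLp hm hl m) h0 hY, hfar, covariance_eq_sub h0 hY,
    iid_Emin hm hl hi (by omega), iid_E hm hl]
  simp_rw [min_comm (X (m+1) _) (X m _), mul_comm (X (m+1) _)] at this
  simp only [Pi.mul_apply]
  rw [this]; norm_num

lemma iid_var_min (hm : ∀ i, Measurable (X i)) (hl : ∀ i, P.map (X i) = mexp)
    (hi : iIndepFun X P) {i j : ℕ} (hij : i ≠ j) :
    Var[fun ω => min (X i ω) (X j ω); P] = 1/4 := by
  rw [variance_eq_sub (iid_min_memLp hm hl _ _), iid_Emin hm hl hi hij]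
  have := iid_Emin2 hm hl hi hij
  simp only [Pi.pow_apply, pow_two]
  rw [this]; norm_num

lemma iid_var (hm : ∀ i, Measurable (X i)) (hl : ∀ i, P.map (X i) = mexp) (i : ℕ) :
    Var[X i; P] = 1 := by
  rw [variance_eq_sub (iid_memLp hm hl _), iid_E hm hl]
  have := iid_E2 hm hl i
  simp only [Pi.pow_apply, pow_two]
  rw [this]; norm_num

lemma Tsum_var (hm : ∀ i, Measurable (X i)) (hl : ∀ i, P.map (X i) = mexp)
    (hi : iIndepFun X P) (m : ℕ) : Var[Tsum X (m+1); P] = 7/4 + m * (5/12) := by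
  induction m with
  | zero =>
    have hc := covariance_eq_sub (iid_memLp hm hl 0) (iid_min_memLp hm hl 0 1)
    have hx := iid_Exmin hm hl hi (i := 0) (j := 1) (by omega)
    simp only [Pi.mul_apply] at hc
    rw [hx, iid_E hm hl, iid_Emin hm hl hi (by omega)] at hc
    rw [Tsum_succ, variance_add (Tsum_memLp hm hl _) (iid_min_memLp hm hl _ _), Tsum_zero,
      iid_var hm hl, iid_var_min hm hl hi (by omega), hc]
    norm_num
  | succ m ih =>
    rw [Tsum_succ, variance_add (Tsum_memLp hm hl _) (iid_min_memLp hm hl _ _),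
      ih, iid_var_min hm hl hi (by omega), Tsum_cov_near hm hl hi m]
    push_cast; ring

noncomputable def Ttot (X : ℕ → Ω → ℝ) (m : ℕ) (ω : Ω) : ℝ := Tsum X (m+1) ω + X (m+1) ω

lemma Ttot_memLp (hm : ∀ i, Measurable (X i)) (hl : ∀ i, P.map (X i) = mexp) (m : ℕ) :
    MemLp (Ttot X m) 2 P := (Tsum_memLp hm hl _).add (iid_memLp hm hl _)

lemma Ttot_E (hm : ∀ i, Measurable (X i)) (hl : ∀ i, P.map (X i) = mexp)
    (hi : iIndepFun X P) (m : ℕ) : ∫ ω, Ttot X m ω ∂P = (m + 5)/2 := by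
  unfold Ttot
  rw [integral_add ((Tsum_memLp hm hl _).integrable one_le_two)
      ((iid_memLp hm hl _).integrable one_le_two), Tsum_E hm hl hi, iid_E hm hl]
  push_cast; ring

lemma Ttot_E2 (hm : ∀ i, Measurable (X i)) (hl : ∀ i, P.map (X i) = mexp)
    (hi : iIndepFun X P) (m : ℕ) :
    ∫ ω, Ttot X m ω ^ 2 ∂P = (m + 5)^2/4 + 13/4 + m * (5/12) := by
  have h1 := variance_eq_sub (Ttot_memLp (P := P) hm hl m)
  have h2 : Var[Ttot X m; P] = 13/4 + m * (5/12) := by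
    have : Ttot X m = Tsum X (m+1) + X (m+1) := rfl
    rw [this, variance_add (Tsum_memLp hm hl _) (iid_memLp hm hl _), Tsum_var hm hl hi,
      iid_var hm hl, Tsum_cov_last hm hl hi]
    ring
  rw [h2, Ttot_E hm hl hi] at h1
  simp only [Pi.pow_apply] at h1
  linarith
end iid
def gap (n : ℕ) [NeZero n] (i : ℕ) (x : Fin n → ℝ) : ℝ :=
  x (Fin.ofNat n (i+1)) - x (Fin.ofNat n i)

noncomputable def nnd {n : ℕ} (x : Fin n → ℝ) (i : Fin n) : ℝ :=
  sInf {d : ℝ | ∃ j : Fin n, j ≠ i ∧ d = |x i - x j|}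

lemma nnWeight_eq {n : ℕ} (x : Fin n → ℝ) : nnWeight 1 x = ∑ i, nnd x i := by
  simp [nnWeight, nnd]

lemma nnd_first (m : ℕ) (x : Fin (m+3) → ℝ) (hx : StrictMono x) :
    nnd x 0 = gap (m+3) 0 x := by
  have h1 : (Fin.ofNat (m+3) (0+1)).val = 1 := by simp
  have h0 : (Fin.ofNat (m+3) 0) = 0 := by ext; simp
  unfold gap
  rw [h0]
  generalize Fin.ofNat (m+3) (0+1) = p at *
  refine IsLeast.csInf_eq ⟨⟨p, ?_, ?_⟩, ?_⟩
  · intro h; rw [h] at h1; simp at h1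
  · have : x 0 < x p := hx (by rw [Fin.lt_def]; simp [h1])
    rw [abs_sub_comm, abs_of_pos (by linarith)]
  · rintro d ⟨j, hj, rfl⟩
    have hj0 : j.val ≠ 0 := fun h => hj (Fin.ext h)
    have : x p ≤ x j := hx.monotone (by rw [Fin.le_def]; omega)
    rw [abs_sub_comm]
    exact le_trans (by linarith) (le_abs_self _)

lemma nnd_last (m : ℕ) (x : Fin (m+3) → ℝ) (hx : StrictMono x) :
    nnd x (Fin.last (m+2)) = gap (m+3) (m+1) x := by
  have h1 : (Fin.ofNat (m+3) (m+1)).val = m+1 := by simp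
  have h0 : (Fin.ofNat (m+3) (m+1+1)) = Fin.last (m+2) := by ext; simp
  unfold gap
  rw [h0]
  generalize Fin.ofNat (m+3) (m+1) = p at *
  refine IsLeast.csInf_eq ⟨⟨p, ?_, ?_⟩, ?_⟩
  · intro h; rw [h] at h1; simp at h1
  · have : x p < x (Fin.last (m+2)) := hx (by rw [Fin.lt_def]; simp [h1])
    rw [abs_of_pos (by linarith)]
  · rintro d ⟨j, hj, rfl⟩
    have hj0 : j.val ≠ m+2 := fun h => hj (Fin.ext h)
    have : x j ≤ x p := hx.monotone (by rw [Fin.le_def]; omega)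
    exact le_trans (by linarith) (le_abs_self _)

lemma nnd_mid (m : ℕ) (x : Fin (m+3) → ℝ) (hx : StrictMono x) (i : Fin (m+3)) (k : ℕ)
    (hi : i.val = k + 1) (hk : k < m + 1) :
    nnd x i = min (gap (m+3) k x) (gap (m+3) (k+1) x) := by
  have h0 : (Fin.ofNat (m+3) k).val = k := by
    simp only [Fin.ofNat]; exact Nat.mod_eq_of_lt (by omega)
  have h1 : (Fin.ofNat (m+3) (k+1)) = i := by
    ext; rw [hi]; simp only [Fin.ofNat]; exact Nat.mod_eq_of_lt (by omega)
  have h2 : (Fin.ofNat (m+3) (k+1+1)).val = k+2 := by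
    simp only [Fin.ofNat]; exact Nat.mod_eq_of_lt (by omega)
  unfold gap
  rw [h1]
  generalize Fin.ofNat (m+3) k = p at *
  generalize Fin.ofNat (m+3) (k+1+1) = q at *
  have a1 : x p < x i := hx (by rw [Fin.lt_def]; omega)
  have a2 : x i < x q := hx (by rw [Fin.lt_def]; omega)
  refine IsLeast.csInf_eq ⟨?_, ?_⟩
  · rcases min_choice (x i - x p) (x q - x i) with h | h <;> rw [h]
    · exact ⟨p, fun h => by rw [h] at h0; omega, by rw [abs_of_pos (by linarith)]⟩
    · exact ⟨q, fun h => by rw [h] at h2; omega,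
        by rw [abs_sub_comm, abs_of_pos (by linarith)]⟩
  · rintro d ⟨j, hj, rfl⟩
    have hj0 : j.val ≠ i.val := fun h => hj (Fin.ext h)
    rcases lt_or_gt_of_ne hj0 with h | h
    · have : x j ≤ x p := hx.monotone (by rw [Fin.le_def]; omega)
      exact (min_le_left _ _).trans (le_trans (by linarith) (le_abs_self _))
    · have : x q ≤ x j := hx.monotone (by rw [Fin.le_def]; omega)
      rw [abs_sub_comm]
      exact (min_le_right _ _).trans (le_trans (by linarith) (le_abs_self _))

lemma nnWeight_sorted (m : ℕ) (x : Fin (m+3) → ℝ) (hx : StrictMono x) :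
    nnWeight 1 x = Ttot (gap (m+3)) m x := by
  rw [nnWeight_eq, Fin.sum_univ_castSucc, Fin.sum_univ_succ]
  unfold Ttot Tsum
  rw [nnd_last m x hx, Finset.sum_range, Fin.castSucc_zero, nnd_first m x hx]
  congr 2
  refine Finset.sum_congr rfl fun i _ => ?_
  exact nnd_mid m x hx _ i (by simp) i.2

lemma nnWeight_perm {n : ℕ} (x : Fin n → ℝ) (σ : Equiv.Perm (Fin n)) :
    nnWeight 1 (x ∘ σ) = nnWeight 1 x := by
  rw [nnWeight_eq, nnWeight_eq, ← Equiv.sum_comp σ (nnd x)]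
  refine Finset.sum_congr rfl fun i _ => ?_
  unfold nnd
  congr 1
  ext d
  constructor
  · rintro ⟨j, hj, rfl⟩; exact ⟨σ j, by simpa using hj, rfl⟩
  · rintro ⟨j, hj, rfl⟩; exact ⟨σ.symm j, by rw [Ne, Equiv.symm_apply_eq]; exact hj, by simp⟩

lemma nnWeight_measurable (n : ℕ) : Measurable (fun x : Fin n → ℝ => nnWeight 1 x) := by
  simp_rw [nnWeight_eq]
  refine Finset.measurable_sum _ fun i _ => ?_
  have : ∀ x : Fin n → ℝ, nnd x i = ⨅ j : {j : Fin n // j ≠ i}, |x i - x j| := by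
    intro x
    unfold nnd iInf
    congr 1
    ext d
    simp only [Set.mem_ofPred_eq, Set.mem_range, Subtype.exists]
    constructor
    · rintro ⟨j, hj, rfl⟩; exact ⟨j, hj, rfl⟩
    · rintro ⟨j, hj, rfl⟩; exact ⟨j, hj, rfl⟩
  simp_rw [this]
  refine Measurable.iInf fun j => ?_
  have : Measurable fun x : Fin n → ℝ => x i - x j := (measurable_pi_apply _).sub (measurable_pi_apply _)
  exact this.abs

lemma nnd_bound {n : ℕ} (x : Fin n → ℝ) (hn : 2 ≤ n) (hx : ∀ i, x i ∈ Set.Ioo (0:ℝ) 1) (i : Fin n) :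
    0 ≤ nnd x i ∧ nnd x i ≤ 1 := by
  constructor
  · apply Real.sInf_nonneg
    rintro d ⟨j, _, rfl⟩; exact abs_nonneg _
  · have : Nontrivial (Fin n) := Fin.nontrivial_iff_two_le.2 hn
    obtain ⟨j, hj⟩ := exists_ne i
    refine le_trans (b := |x i - x j|) (csInf_le ⟨0, ?_⟩ ⟨j, hj, rfl⟩) ?_
    · rintro d ⟨j, _, rfl⟩; exact abs_nonneg _
    · have := hx i; have := hx j
      simp only [Set.mem_Ioo] at *
      rw [abs_le]; constructor <;> linarith

lemma unif_eq (n : ℕ) : unif n = volume.restrict (Set.univ.pi fun _ : Fin n => Set.Ioo (0:ℝ) 1) := by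
  unfold unif
  rw [volume_pi, Measure.restrict_pi_pi]

instance (n : ℕ) : IsProbabilityMeasure (unif n) := by
  unfold unif
  have : IsProbabilityMeasure (volume.restrict (Set.Ioo (0:ℝ) 1)) := ⟨by simp⟩
  infer_instance

lemma nnWeight_memLp (n : ℕ) (hn : 2 ≤ n) (p : ENNReal) : MemLp (fun x : Fin n → ℝ => nnWeight 1 x) p (unif n) := by
  refine MemLp.of_bound (nnWeight_measurable n).aestronglyMeasurable n ?_
  rw [unif_eq]
  filter_upwards [ae_restrict_mem (MeasurableSet.univ_pi fun _ => measurableSet_Ioo)] with x hx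
  have hb := nnd_bound x hn (fun i => hx i (Set.mem_univ _))
  rw [nnWeight_eq, Real.norm_eq_abs, abs_of_nonneg (Finset.sum_nonneg fun i _ => (hb i).1)]
  refine (Finset.sum_le_sum fun i _ => (hb i).2).trans ?_
  simp

/-- The sorted points of `(0,L)`. -/
def Dset (n : ℕ) (L : ℝ) : Set (Fin n → ℝ) := {y | StrictMono y ∧ ∀ i, 0 < y i ∧ y i < L}

lemma strictMono_meas (n : ℕ) : MeasurableSet {y : Fin n → ℝ | StrictMono y} := by
  have : {y : Fin n → ℝ | StrictMono y} = ⋂ i, ⋂ j, {y | i < j → y i < y j} := by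
    ext y; simp [StrictMono]
  rw [this]
  refine MeasurableSet.iInter fun i => MeasurableSet.iInter fun j => ?_
  by_cases h : i < j
  · simp only [h, true_imp_iff]
    exact measurableSet_lt (measurable_pi_apply _) (measurable_pi_apply _)
  · simp [h]

lemma inj_ae (n : ℕ) : ∀ᵐ x : Fin n → ℝ, Function.Injective x := by
  have : ∀ i j : Fin n, i ≠ j → ∀ᵐ x : Fin n → ℝ, x i ≠ x j := by
    intro i j hij
    let S : Submodule ℝ (Fin n → ℝ) := LinearMap.ker (LinearMap.proj (R := ℝ) (φ := fun _ : Fin n => ℝ) i - LinearMap.proj j)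
    have hS : S ≠ ⊤ := by
      intro h
      have : (Pi.single i 1 : Fin n → ℝ) ∈ S := by rw [h]; trivial
      simp [S, LinearMap.mem_ker, hij.symm] at this
    have := Measure.addHaar_submodule (volume : Measure (Fin n → ℝ)) S hS
    rw [ae_iff]
    convert this using 2
    ext x
    simp [S, LinearMap.mem_ker, sub_eq_zero]
  have h2 : ∀ᵐ x : Fin n → ℝ, ∀ i j : Fin n, i ≠ j → x i ≠ x j := by
    rw [ae_all_iff]; intro i
    rw [ae_all_iff]; intro j
    by_cases h : i = j
    · simp [h]
    · filter_upwards [this i j h] with x hx _ using hx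
  filter_upwards [h2] with x hx i j hij
  by_contra h
  exact hx i j h hij

lemma sort_integral (n : ℕ) (F : (Fin n → ℝ) → ℝ) (hF : Integrable F (unif n))
    (hs : ∀ x (σ : Equiv.Perm (Fin n)), F (x ∘ σ) = F x) :
    ∫ x, F x ∂(unif n) = n.factorial * ∫ x in Dset n 1, F x := by
  rw [unif_eq] at *
  let U : Set (Fin n → ℝ) := Set.univ.pi fun _ : Fin n => Set.Ioo (0:ℝ) 1
  let A : Equiv.Perm (Fin n) → Set (Fin n → ℝ) := fun σ => (fun x => x ∘ σ) ⁻¹' (Dset n 1)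
  have hDm : MeasurableSet (Dset n 1) := by
    have : Dset n 1 = {y | StrictMono y} ∩ U := by
      ext y; simp [Dset, U]
    rw [this]
    exact (strictMono_meas n).inter (MeasurableSet.univ_pi fun _ => measurableSet_Ioo)
  have hmp : ∀ σ : Equiv.Perm (Fin n), MeasurePreserving (fun x : Fin n → ℝ => x ∘ σ) volume volume ∧
      MeasurableEmbedding (fun x : Fin n → ℝ => x ∘ σ) := by
    intro σ
    have e : (fun x : Fin n → ℝ => x ∘ σ) = MeasurableEquiv.piCongrLeft (fun _ => ℝ) σ.symm := by
      ext x i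
      have := MeasurableEquiv.piCongrLeft_apply_apply (β := fun _ : Fin n => ℝ) σ.symm x (σ i)
      simp at this
      simp [this]
    rw [e]
    exact ⟨volume_measurePreserving_piCongrLeft (fun _ => ℝ) σ.symm, MeasurableEquiv.measurableEmbedding _⟩
  have hAU : ∀ σ, A σ ⊆ U := by
    intro σ x hx i _
    have := hx.2 (σ.symm i)
    simpa using this
  have hUA : U =ᵐ[volume] ⋃ σ, A σ := by
    filter_upwards [inj_ae n] with x hx
    apply propext
    constructor
    · intro hU
      refine Set.mem_iUnion.2 ⟨Tuple.sort x, ?_, ?_⟩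
      · exact (Tuple.monotone_sort x).strictMono_of_injective (hx.comp (Tuple.sort x).injective)
      · intro i; exact hU _ (Set.mem_univ _)
    · intro h
      obtain ⟨σ, hσ⟩ := Set.mem_iUnion.1 h
      exact hAU σ hσ
  rw [setIntegral_congr_set hUA, integral_iUnion_fintype]
  · have : ∀ σ : Equiv.Perm (Fin n), ∫ x in A σ, F x = ∫ x in Dset n 1, F x := by
      intro σ
      have := (hmp σ).1.setIntegral_preimage_emb (hmp σ).2 F (Dset n 1)
      simp only [hs] at this
      exact this
    simp [this, Fintype.card_perm]
  · intro σ; exact (hmp σ).1.measurable hDm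
  · intro σ τ hst
    refine Set.disjoint_left.2 fun x h1 h2 => hst ?_
    have e := Tuple.unique_monotone h1.1.monotone h2.1.monotone
    have hinj : Function.Injective x := by
      have : Function.Injective ((x ∘ σ) ∘ σ.symm) := h1.1.injective.comp σ.symm.injective
      simpa [Function.comp_assoc] using this
    ext i
    have := hinj (congrFun e i)
    rw [this]
  · intro σ; exact IntegrableOn.mono_set hF (hAU σ)
lemma gap_meas (n : ℕ) [NeZero n] (i : ℕ) : Measurable (gap n i) :=
  (measurable_pi_apply _).sub (measurable_pi_apply _)

lemma Ttot_meas {Ω : Type*} [MeasurableSpace Ω] (X : ℕ → Ω → ℝ) (hX : ∀ i, Measurable (X i)) (m : ℕ) :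
    Measurable (Ttot X m) := by
  unfold Ttot Tsum
  fun_prop

lemma Ttot_smul (n m : ℕ) [NeZero n] (L : ℝ) (hL : 0 < L) (y : Fin n → ℝ) :
    Ttot (gap n) m (L • y) = L * Ttot (gap n) m y := by
  have : ∀ i, gap n i (L • y) = L * gap n i y := by
    intro i; simp [gap, mul_sub]
  simp only [Ttot, Tsum, this, mul_add, Finset.mul_sum, mul_min_of_nonneg _ _ hL.le]

lemma Dset_smul (n : ℕ) (L : ℝ) (hL : 0 < L) (y : Fin n → ℝ) : L • y ∈ Dset n L ↔ y ∈ Dset n 1 := by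
  constructor
  · rintro ⟨h1, h2⟩
    refine ⟨fun i j hij => ?_, fun i => ?_⟩
    · have := h1 hij
      simp only [Pi.smul_apply, smul_eq_mul] at this
      exact lt_of_mul_lt_mul_left this hL.le
    · have := h2 i
      simp only [Pi.smul_apply, smul_eq_mul] at this
      exact ⟨(mul_pos_iff_of_pos_left hL).1 this.1, by nlinarith [this.2]⟩
  · rintro ⟨h1, h2⟩
    refine ⟨fun i j hij => ?_, fun i => ?_⟩
    · exact mul_lt_mul_of_pos_left (h1 hij) hL
    · have := h2 i
      simp only [Pi.smul_apply, smul_eq_mul]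
      exact ⟨mul_pos hL this.1, by nlinarith [this.2]⟩

lemma Dset_meas (n : ℕ) (L : ℝ) : MeasurableSet (Dset n L) := by
  have : Dset n L = {y | StrictMono y} ∩ (Set.univ.pi fun _ : Fin n => Set.Ioo (0:ℝ) L) := by
    ext y; simp [Dset]
  rw [this]
  exact (strictMono_meas n).inter (MeasurableSet.univ_pi fun _ => measurableSet_Ioo)

lemma Dset_scale (n m k : ℕ) [NeZero n] (L : ℝ) (hL : 0 < L) :
    ∫ y in Dset n L, Ttot (gap n) m y ^ k = L ^ (n + k) * ∫ y in Dset n 1, Ttot (gap n) m y ^ k := by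
  rw [← integral_indicator (Dset_meas n L), ← integral_indicator (Dset_meas n 1)]
  have h := Measure.integral_comp_smul (volume : Measure (Fin n → ℝ))
    ((Dset n L).indicator fun y => Ttot (gap n) m y ^ k) L
  have e : ∀ y, ((Dset n L).indicator fun y => Ttot (gap n) m y ^ k) (L • y) =
      L ^ k * ((Dset n 1).indicator fun y => Ttot (gap n) m y ^ k) y := by
    intro y
    by_cases hy : y ∈ Dset n 1
    · rw [Set.indicator_of_mem hy, Set.indicator_of_mem ((Dset_smul n L hL y).2 hy), Ttot_smul _ _ _ hL,
        mul_pow]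
    · rw [Set.indicator_of_notMem hy, Set.indicator_of_notMem (fun h => hy ((Dset_smul n L hL y).1 h)),
        mul_zero]
  simp_rw [e] at h
  rw [integral_const_mul] at h
  simp only [Module.finrank_fintype_fun_eq_card, Fintype.card_fin, smul_eq_mul] at h
  rw [abs_of_pos (by positivity)] at h
  rw [pow_add, mul_assoc, h]
  field_simp

lemma pi_mexp (n : ℕ) : Measure.pi (fun _ : Fin n => mexp) =
    (volume.restrict (Set.univ.pi fun _ : Fin n => Set.Ioi (0:ℝ))).withDensity
      (fun e => ENNReal.ofReal (Real.exp (-∑ i, e i))) := by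
  have hint : Integrable (fun x : ℝ => Real.exp (-x)) (volume.restrict (Set.Ioi (0:ℝ))) := by
    have h := gam_integrableOn 0 1 one_pos
    simp at h
    exact h
  symm
  refine (Measure.pi_eq fun s hs => ?_).symm
  rw [withDensity_apply _ (MeasurableSet.univ_pi hs), volume_pi, Measure.restrict_pi_pi,
    Measure.restrict_pi_pi]
  have h : ∀ e : Fin n → ℝ, Real.exp (-∑ i, e i) = ∏ i, Real.exp (-(e i)) := by
    intro e; rw [← Finset.sum_neg_distrib, Real.exp_sum]
  simp_rw [h]
  rw [← ofReal_integral_eq_lintegral_ofReal]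
  · rw [integral_fintype_prod_eq_prod (fun _ : Fin n => fun x : ℝ => Real.exp (-x)),
      ENNReal.ofReal_prod_of_nonneg]
    · refine Finset.prod_congr rfl fun i _ => ?_
      rw [mexp, withDensity_apply _ (hs i), ofReal_integral_eq_lintegral_ofReal]
      · exact hint.restrict
      · exact Filter.Eventually.of_forall fun x => (Real.exp_pos _).le
    · intro i _
      exact integral_nonneg fun x => (Real.exp_pos _).le
  · exact Integrable.fintype_prod (f := fun _ : Fin n => fun x : ℝ => Real.exp (-x)) fun i => hint.restrict
  · exact Filter.Eventually.of_forall fun x => Finset.prod_nonneg fun i _ => (Real.exp_pos _).le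

/-- cumulative sums -/
def cumM (n : ℕ) : Matrix (Fin n) (Fin n) ℝ := fun i j => if j ≤ i then 1 else 0

lemma cumM_det (n : ℕ) : (cumM n).det = 1 := by
  rw [Matrix.det_of_isLowerTriangular]
  · simp [cumM]
  · intro i j hij
    have : i < j := hij
    simp [cumM, this]

lemma cum_mp (n : ℕ) : MeasurePreserving (fun e : Fin n → ℝ => fun i => ∑ j, if j ≤ i then e j else 0)
    volume volume := by
  have e1 : (fun e : Fin n → ℝ => fun i => ∑ j, if j ≤ i then e j else 0) = Matrix.toLin' (cumM n) := by
    ext e i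
    simp [cumM, Matrix.mulVec, dotProduct]
  rw [e1]
  refine ⟨(LinearMap.continuous_of_finiteDimensional _).measurable, ?_⟩
  rw [Real.map_matrix_volume_pi_eq_smul_volume_pi (by rw [cumM_det]; norm_num), cumM_det]
  simp

lemma cum_diff {n : ℕ} (e : Fin n → ℝ) (i j : Fin n) (hij : j.val = i.val + 1) :
    (∑ k, if k ≤ j then e k else 0) - (∑ k, if k ≤ i then e k else 0) = e j := by
  rw [← Finset.sum_sub_distrib]
  rw [Finset.sum_eq_single j]
  · have : ¬ j ≤ i := by rw [Fin.le_def]; omega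
    simp [this]
  · intro k _ hk
    have hk' : k.val ≠ j.val := fun h => hk (Fin.ext h)
    by_cases h : k ≤ i
    · have : k ≤ j := by rw [Fin.le_def] at *; omega
      simp [h, this]
    · have : ¬ k ≤ j := by rw [Fin.le_def] at *; omega
      simp [h, this]
  · simp

lemma Ttot_congr {Ω Ω' : Type*} (X : ℕ → Ω → ℝ) (Y : ℕ → Ω' → ℝ) (m : ℕ) (ω : Ω) (ω' : Ω')
    (h : ∀ i, i ≤ m + 1 → X i ω = Y i ω') : Ttot X m ω = Ttot Y m ω' := by
  unfold Ttot Tsum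
  rw [h 0 (by omega), h (m+1) le_rfl]
  congr 2
  refine Finset.sum_congr rfl fun i hi => ?_
  have := Finset.mem_range.1 hi
  rw [h i (by omega), h (i+1) (by omega)]

/-- The integrand on the cone of increasing sequences. -/
noncomputable def gfun (m k : ℕ) : (Fin (m+3+1) → ℝ) → ℝ :=
  Set.indicator {z | StrictMono z ∧ 0 < z 0}
    (fun z => Real.exp (-z (Fin.last (m+3))) * Ttot (gap (m+3)) m (fun i => z i.castSucc) ^ k)

lemma gfun_meas (m k : ℕ) : Measurable (gfun m k) := by
  refine Measurable.indicator ?_ ?_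
  · refine Measurable.mul (by fun_prop) (Measurable.pow_const ?_ k)
    exact (Ttot_meas _ (gap_meas _) m).comp (by fun_prop)
  · exact (strictMono_meas _).inter (measurableSet_lt measurable_const (measurable_pi_apply _))

/-- spacings as coordinates -/
def spc (m : ℕ) (i : ℕ) (e : Fin (m+3+1) → ℝ) : ℝ := e (Fin.ofNat (m+3+1) (i+1))

lemma gfun_cum (m k : ℕ) (e : Fin (m+3+1) → ℝ) :
    gfun m k (fun i => ∑ j, if j ≤ i then e j else 0) =
    (Set.univ.pi fun _ : Fin (m+3+1) => Set.Ioi (0:ℝ)).indicator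
      (fun e => Real.exp (-∑ i, e i) * Ttot (spc m) m e ^ k) e := by
  have h0 : (∑ j, if j ≤ (0 : Fin (m+3+1)) then e j else 0) = e 0 := by
    simp
  have hiff : (fun i => ∑ j, if j ≤ i then e j else 0) ∈ {z : Fin (m+3+1) → ℝ | StrictMono z ∧ 0 < z 0} ↔
      e ∈ (Set.univ.pi fun _ : Fin (m+3+1) => Set.Ioi (0:ℝ)) := by
    constructor
    · rintro ⟨h1, h2⟩ i _
      refine Fin.cases ?_ (fun j => ?_) i
      · rw [← h0]; exact h2
      · have a := h1 (Fin.castSucc_lt_succ (i := j))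
        have b := cum_diff e j.castSucc j.succ (by simp)
        simp only at a
        show 0 < e j.succ
        linarith
    · intro h
      refine ⟨Fin.strictMono_iff_lt_succ.2 fun j => ?_, ?_⟩
      · have b := cum_diff e j.castSucc j.succ (by simp)
        have c : 0 < e j.succ := h _ (Set.mem_univ _)
        linarith
      · simp only [h0]; exact h 0 (Set.mem_univ _)
  unfold gfun
  by_cases h : e ∈ (Set.univ.pi fun _ : Fin (m+3+1) => Set.Ioi (0:ℝ))
  · rw [Set.indicator_of_mem h, Set.indicator_of_mem (hiff.2 h)]
    have hl : (∑ j, if j ≤ Fin.last (m+3) then e j else 0) = ∑ j, e j := by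
      simp [Fin.le_last]
    simp only [hl]
    congr 2
    refine Ttot_congr _ _ _ _ _ fun i hi => ?_
    unfold gap spc
    have v1 : (Fin.ofNat (m+3) (i+1)).val = i+1 := Nat.mod_eq_of_lt (by omega)
    have v0 : (Fin.ofNat (m+3) i).val = i := Nat.mod_eq_of_lt (by omega)
    have v2 : (Fin.ofNat (m+3+1) (i+1)).val = i+1 := Nat.mod_eq_of_lt (by omega)
    simp only
    rw [cum_diff e _ _ (by simp only [Fin.val_castSucc]; omega)]
    congr 1
    ext; simp only [Fin.val_castSucc]; omega
  · rw [Set.indicator_of_notMem h, Set.indicator_of_notMem (fun h' => h (hiff.1 h'))]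

lemma gfun_snoc (m k : ℕ) (L : ℝ) (y : Fin (m+3) → ℝ) :
    gfun m k (Fin.snoc (α := fun _ => ℝ) y L) =
      Real.exp (-L) * (Dset (m+3) L).indicator (fun y => Ttot (gap (m+3)) m y ^ k) y := by
  have hiff : (Fin.snoc (α := fun _ => ℝ) y L) ∈ {z : Fin (m+3+1) → ℝ | StrictMono z ∧ 0 < z 0} ↔
      y ∈ Dset (m+3) L := by
    have hz : (Fin.snoc (α := fun _ => ℝ) y L : Fin (m+3+1) → ℝ) 0 = y 0 := by
      rw [← Fin.castSucc_zero, Fin.snoc_castSucc]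
    constructor
    · rintro ⟨h1, h2⟩
      have hmono : StrictMono y := by
        intro i j hij
        have := h1 (Fin.castSucc_lt_castSucc_iff.2 hij)
        simpa using this
      refine ⟨hmono, fun i => ⟨?_, ?_⟩⟩
      · rw [hz] at h2
        exact h2.trans_le (hmono.monotone (Fin.zero_le i))
      · have := h1 (Fin.castSucc_lt_last i)
        simpa using this
    · rintro ⟨h1, h2⟩
      refine ⟨?_, by rw [hz]; exact (h2 0).1⟩
      intro i j hij
      induction j using Fin.lastCases with
      | last =>
        induction i using Fin.lastCases with
        | last => exact absurd hij (lt_irrefl _)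
        | cast i => simpa using (h2 i).2
      | cast j =>
        induction i using Fin.lastCases with
        | last => exact absurd hij (not_lt.2 (Fin.le_last _))
        | cast i => simpa using h1 (Fin.castSucc_lt_castSucc_iff.1 hij)
  unfold gfun
  by_cases h : y ∈ Dset (m+3) L
  · rw [Set.indicator_of_mem h, Set.indicator_of_mem (hiff.2 h)]
    simp
  · rw [Set.indicator_of_notMem h, Set.indicator_of_notMem (fun h' => h (hiff.1 h')), mul_zero]

lemma gfun_integral_exp (m k : ℕ) :
    ∫ e, Ttot (spc m) m e ^ k ∂(Measure.pi fun _ : Fin (m+3+1) => mexp) = ∫ z, gfun m k z := by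
  have hU : MeasurableSet (Set.univ.pi fun _ : Fin (m+3+1) => Set.Ioi (0:ℝ)) :=
    MeasurableSet.univ_pi fun _ => measurableSet_Ioi
  rw [pi_mexp, integral_withDensity_eq_integral_toReal_smul (by fun_prop) (by simp)]
  rw [← (cum_mp (m+3+1)).map_eq, integral_map (cum_mp _).measurable.aemeasurable
    (gfun_meas m k).aestronglyMeasurable]
  simp_rw [gfun_cum]
  rw [integral_indicator hU, (cum_mp (m+3+1)).map_eq]
  simp [ENNReal.toReal_ofReal (Real.exp_pos _).le]

lemma gfun_integrable (m k : ℕ)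
    (h : Integrable (fun e => Ttot (spc m) m e ^ k) (Measure.pi fun _ : Fin (m+3+1) => mexp)) :
    Integrable (gfun m k) := by
  have hU : MeasurableSet (Set.univ.pi fun _ : Fin (m+3+1) => Set.Ioi (0:ℝ)) :=
    MeasurableSet.univ_pi fun _ => measurableSet_Ioi
  rw [pi_mexp, integrable_withDensity_iff_integrable_smul' (by fun_prop) (by simp)] at h
  rw [← (cum_mp (m+3+1)).integrable_comp (gfun_meas m k).aestronglyMeasurable]
  have e : gfun m k ∘ (fun e : Fin (m+3+1) → ℝ => fun i => ∑ j, if j ≤ i then e j else 0) = 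
    (Set.univ.pi fun _ : Fin (m+3+1) => Set.Ioi (0:ℝ)).indicator
      (fun e => Real.exp (-∑ i, e i) * Ttot (spc m) m e ^ k) := by
    ext e; exact gfun_cum m k e
  rw [e, integrable_indicator_iff hU]
  simpa [ENNReal.toReal_ofReal (Real.exp_pos _).le, IntegrableOn] using h

lemma gfun_integral_D (m k : ℕ) (hg : Integrable (gfun m k)) :
    ∫ z, gfun m k z = ((m+3+k).factorial : ℝ) * ∫ y in Dset (m+3) 1, Ttot (gap (m+3)) m y ^ k := by
  have hp := (volume_preserving_piFinSuccAbove (fun _ : Fin (m+3+1) => ℝ) (Fin.last (m+3))).symm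
  have hs : ∀ p : ℝ × (Fin (m+3) → ℝ),
      (MeasurableEquiv.piFinSuccAbove (fun _ : Fin (m+3+1) => ℝ) (Fin.last (m+3))).symm p =
        Fin.snoc (α := fun _ => ℝ) p.2 p.1 := by
    intro p
    exact Fin.insertNth_last' (β := ℝ) p.1 p.2
  have hg2 := (hp.integrable_comp_emb (MeasurableEquiv.measurableEmbedding _)).2 hg
  rw [Function.comp_def] at hg2
  rw [← hp.integral_comp']
  rw [Measure.volume_eq_prod] at *
  rw [integral_prod _ hg2]
  simp_rw [hs, gfun_snoc, integral_const_mul]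
  simp_rw [integral_indicator (Dset_meas (m+3) _)]
  have e1 : (fun L : ℝ => Real.exp (-L) * ∫ y in Dset (m+3) L, Ttot (gap (m+3)) m y ^ k) =
      (Set.Ioi (0:ℝ)).indicator (fun L => L ^ (m+3+k) * Real.exp (-(1 * L)) *
        ∫ y in Dset (m+3) 1, Ttot (gap (m+3)) m y ^ k) := by
    ext L
    by_cases hL : 0 < L
    · rw [Set.indicator_of_mem (show L ∈ Set.Ioi (0:ℝ) from hL), Dset_scale _ _ _ _ hL]
      rw [one_mul]; ring
    · rw [Set.indicator_of_notMem (show L ∉ Set.Ioi (0:ℝ) from hL)]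
      have : Dset (m+3) L = ∅ := by
        ext y
        simp only [Set.mem_empty_iff_false, iff_false]
        rintro ⟨_, h⟩
        have := h 0
        exact hL (this.1.trans this.2)
      rw [this]; simp
  rw [e1, integral_indicator measurableSet_Ioi, integral_mul_const, gam_integral _ _ one_pos]
  simp

lemma shift_iid : ∃ (Q : Measure (ℕ → ℝ)), IsProbabilityMeasure Q ∧
    (∀ i, Q.map (fun ω => ω i) = mexp) ∧ iIndepFun (fun i (ω : ℕ → ℝ) => ω i) Q := by
  refine ⟨Measure.infinitePi (fun _ => mexp), inferInstance, fun i => ?_, ?_⟩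
  · exact (measurePreserving_eval_infinitePi (fun _ : ℕ => mexp) i).map_eq
  · exact iIndepFun_infinitePi (P := fun _ : ℕ => mexp) (X := fun _ x => x) (fun _ => measurable_id)

lemma exp_moments (m : ℕ) :
    MemLp (Ttot (spc m) m) 2 (Measure.pi fun _ : Fin (m+3+1) => mexp) ∧
    ∫ e, Ttot (spc m) m e ∂(Measure.pi fun _ : Fin (m+3+1) => mexp) = (m + 5)/2 ∧
    ∫ e, Ttot (spc m) m e ^ 2 ∂(Measure.pi fun _ : Fin (m+3+1) => mexp)
      = (m + 5)^2/4 + 13/4 + m * (5/12) := by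
  obtain ⟨Q, hQ, hl, hi⟩ := shift_iid
  have hm : ∀ i : ℕ, Measurable (fun ω : ℕ → ℝ => ω (i+1)) := fun i => measurable_pi_apply _
  have hl' : ∀ i : ℕ, Q.map (fun ω => ω (i+1)) = mexp := fun i => hl _
  have hi' : iIndepFun (fun i (ω : ℕ → ℝ) => ω (i+1)) Q :=
    hi.precomp (g := fun i => i + 1) (add_left_injective 1)
  have hV : Measurable (fun (ω : ℕ → ℝ) (i : Fin (m+3+1)) => ω i) := by fun_prop
  have hmap : Q.map (fun (ω : ℕ → ℝ) (i : Fin (m+3+1)) => ω i) =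
      Measure.pi fun _ : Fin (m+3+1) => mexp := by
    have h1 : iIndepFun (fun (i : Fin (m+3+1)) (ω : ℕ → ℝ) => ω i) Q :=
      hi.precomp (g := fun i : Fin (m+3+1) => (i : ℕ)) Fin.val_injective
    rw [iIndepFun_iff_map_fun_eq_pi_map (fun i => (measurable_pi_apply _).aemeasurable)] at h1
    rw [h1]
    simp only [hl]
  have hsp : ∀ i, Measurable (spc m i) := fun i => measurable_pi_apply _
  have hT := Ttot_meas (spc m) hsp m
  have hc : ∀ ω : ℕ → ℝ, Ttot (spc m) m (fun i : Fin (m+3+1) => ω i) =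
      Ttot (fun i (ω : ℕ → ℝ) => ω (i+1)) m ω := by
    intro ω
    refine Ttot_congr _ _ _ _ _ fun i hi => ?_
    have v2 : (Fin.ofNat (m+3+1) (i+1)).val = i+1 := Nat.mod_eq_of_lt (by omega)
    simp only [spc, v2]
  refine ⟨?_, ?_, ?_⟩
  · rw [← hmap, memLp_map_measure_iff hT.aestronglyMeasurable hV.aemeasurable]
    have := Ttot_memLp hm hl' m
    refine this.congr_norm (hT.comp hV).aestronglyMeasurable (Filter.Eventually.of_forall fun ω => ?_)
    simp only [Function.comp_apply, hc]
  · rw [← hmap, integral_map hV.aemeasurable hT.aestronglyMeasurable]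
    simp only [hc]
    exact Ttot_E hm hl' hi' m
  · rw [← hmap, integral_map hV.aemeasurable (hT.pow_const 2).aestronglyMeasurable]
    simp only [hc]
    exact Ttot_E2 hm hl' hi' m

lemma nn_moment (m k : ℕ) (I : ℝ)
    (hint : Integrable (fun e => Ttot (spc m) m e ^ k) (Measure.pi fun _ : Fin (m+3+1) => mexp))
    (hI : ∫ e, Ttot (spc m) m e ^ k ∂(Measure.pi fun _ : Fin (m+3+1) => mexp) = I) :
    ∫ x, nnWeight 1 x ^ k ∂(unif (m+3)) = (m+3).factorial * (I / (m+3+k).factorial) := by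
  rw [gfun_integral_exp, gfun_integral_D m k (gfun_integrable m k hint)] at hI
  rw [sort_integral (m+3) (fun x => nnWeight 1 x ^ k)]
  · congr 1
    rw [← hI]
    have : ((m+3+k).factorial : ℝ) ≠ 0 := by positivity
    rw [mul_div_cancel_left₀ _ this]
    refine setIntegral_congr_fun (Dset_meas _ _) fun x hx => ?_
    rw [nnWeight_sorted m x hx.1]
  · refine Integrable.of_bound ((nnWeight_measurable _).pow_const k).aestronglyMeasurable ((m+3 : ℕ) ^ k : ℝ) ?_
    rw [unif_eq]
    filter_upwards [ae_restrict_mem (MeasurableSet.univ_pi fun _ => measurableSet_Ioo)] with x hx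
    have hb := nnd_bound x (by omega) (fun i => hx i (Set.mem_univ _))
    rw [norm_pow, nnWeight_eq, Real.norm_eq_abs,
      abs_of_nonneg (Finset.sum_nonneg fun i _ => (hb i).1)]
    refine pow_le_pow_left₀ (Finset.sum_nonneg fun i _ => (hb i).1) ?_ k
    refine (Finset.sum_le_sum fun i _ => (hb i).2).trans ?_
    simp
  · intro x σ; rw [nnWeight_perm]

lemma nn_var (n : ℕ) (hn : 4 ≤ n) :
    ProbabilityTheory.variance (fun u => nnWeight 1 u) (unif n)
        = (2*(n:ℝ)^2 + 17*(n:ℝ) + 12) / (12*((n:ℝ)+1)^2*((n:ℝ)+2)) := by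
  obtain ⟨m, rfl⟩ : ∃ m, n = m + 3 := ⟨n - 3, by omega⟩
  obtain ⟨h0, h1, h2⟩ := exp_moments m
  have e1 := nn_moment m 1 _ (by simpa using h0.integrable one_le_two) (by simpa using h1)
  have e2 := nn_moment m 2 _ h0.integrable_sq h2
  rw [variance_eq_sub (nnWeight_memLp _ (by omega) 2)]
  simp only [pow_one] at e1
  simp only [Pi.pow_apply]
  rw [e1, e2]
  rw [show m+3+2 = (m+3+1)+1 by rfl, Nat.factorial_succ (m+3+1), Nat.factorial_succ (m+3)]
  have : ((m+3).factorial : ℝ) ≠ 0 := by positivity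
  push_cast
  have a1 : (m:ℝ)+3+1 ≠ 0 := by positivity
  have a2 : (m:ℝ)+3+2 ≠ 0 := by positivity
  have a3 : (m:ℝ)+3+1+1 ≠ 0 := by positivity
  field_simp
  ring

/-- The variance of the total length (`α = 1`) of the nearest-neighbour directed graph
on `n ≥ 4` i.i.d. uniform points on `(0,1)` equals `(2n²+17n+12)/(12(n+1)²(n+2))`,
which equals `(1/6)n⁻¹ + O(n⁻²)`. -/
theorem nn_variance_alpha_one :
    (∀ n : ℕ, 4 ≤ n →
      ProbabilityTheory.variance (fun u => nnWeight 1 u) (unif n)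
        = (2*(n:ℝ)^2 + 17*(n:ℝ) + 12) / (12*((n:ℝ)+1)^2*((n:ℝ)+2)))
    ∧ (fun n : ℕ =>
        ProbabilityTheory.variance (fun u => nnWeight 1 u) (unif n) - 1/(6*(n:ℝ)))
        =O[Filter.atTop] fun n : ℕ => (n:ℝ)^(-2 : ℤ) := by
  refine ⟨nn_var, ?_⟩
  refine IsBigO.of_bound 1 ?_
  filter_upwards [Filter.eventually_ge_atTop 4] with n hn
  rw [nn_var n hn]
  have hn' : (4:ℝ) ≤ n := by exact_mod_cast hn
  have hpos : (0:ℝ) < n := by linarith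
  have e : (2*(n:ℝ)^2 + 17*(n:ℝ) + 12) / (12*((n:ℝ)+1)^2*((n:ℝ)+2)) - 1/(6*(n:ℝ)) =
      (9*(n:ℝ)^2 + 2*n - 4) / (12*n*((n:ℝ)+1)^2*((n:ℝ)+2)) := by
    field_simp
    ring
  have hz : (n:ℝ)^(-2:ℤ) = 1 / (n:ℝ)^2 := by
    rw [zpow_neg, one_div]; norm_cast
  rw [e, hz, one_mul, Real.norm_eq_abs, Real.norm_eq_abs, abs_of_nonneg, abs_of_nonneg (by positivity)]
  · rw [div_le_div_iff₀ (by positivity) (by positivity)]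
    have h4 : 0 ≤ (n:ℝ)^4 := by positivity
    have h3 : 0 ≤ (n:ℝ)^3 := by positivity
    nlinarith
  · refine div_nonneg ?_ (by positivity)
    nlinarith
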